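/- Let d ≥ 1, ε > 0, and let f ∈ C_c^∞(ℝ^d) be not identically zero. Define g(x) := ((E_ε f²)(x))^{1/2} = (∫_{ℝ^d} k(ε, x−y) f(y)² dy)^{1/2}. Then g is everywhere positive and smooth, and ∫_{ℝ^d} |∇g(x)|² dx ≤ ∫_{ℝ^d} |∇f(x)|² dx. -/

import Mathlib

open MeasureTheory Real
open scoped RealInnerProductSpace ENNReal

abbrev Euc (d : ℕ) := EuclideanSpace ℝ (Fin d)

/-- The Gauss–Weierstrass heat kernel `k(t,x) = (4πt)^{-d/2} exp(-|x|²/(4t))`. -/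
noncomputable def heatKer (d : ℕ) (t : ℝ) (x : Euc d) : ℝ :=
  (4 * Real.pi * t) ^ (-(d : ℝ) / 2) * Real.exp (-‖x‖ ^ 2 / (4 * t))


theorem heatKer_pos' (d : ℕ) {t : ℝ} (ht : 0 < t) (x : Euc d) : 0 < heatKer d t x := by
  unfold heatKer
  have := Real.pi_pos
  positivity

theorem heatKer_cont (d : ℕ) (t : ℝ) : Continuous (heatKer d t) := by
  unfold heatKer
  fun_prop

theorem heatKer_integral (d : ℕ) {t : ℝ} (ht : 0 < t) : ∫ x, heatKer d t x = 1 := by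
  unfold heatKer
  rw [integral_const_mul]
  have h := GaussianFourier.integral_rexp_neg_mul_sq_norm (V := Euc d) (b := 1 / (4 * t)) (by positivity)
  have e : ∀ x : Euc d, -‖x‖ ^ 2 / (4 * t) = -(1 / (4 * t)) * ‖x‖ ^ 2 := fun x => by ring
  simp_rw [e]
  rw [h]
  have hp := Real.pi_pos
  have e2 : Real.pi / (1 / (4 * t)) = 4 * Real.pi * t := by field_simp
  rw [e2, finrank_euclideanSpace_fin, ← Real.rpow_add (by positivity)]
  have : -(d : ℝ) / 2 + d / 2 = 0 := by ring
  rw [this, Real.rpow_zero]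

theorem heatKer_integrable (d : ℕ) {t : ℝ} (ht : 0 < t) : Integrable (heatKer d t) := by
  by_contra h
  have := heatKer_integral d ht
  rw [integral_undef h] at this
  norm_num at this

theorem norm_gradient_eq' (d : ℕ) (f : Euc d → ℝ) (x : Euc d) : ‖gradient f x‖ = ‖fderiv ℝ f x‖ := by
  simp [gradient]

theorem sqrt_heat_mollification_gradient_bound
    (d : ℕ) (hd : 1 ≤ d) (ε : ℝ) (hε : 0 < ε)
    (f : Euc d → ℝ) (hf : ContDiff ℝ (⊤ : ℕ∞) f) (hsupp : HasCompactSupport f) (hf0 : f ≠ 0) :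
    (∀ x : Euc d, 0 < Real.sqrt (∫ y, heatKer d ε (x - y) * f y ^ 2))
    ∧ ContDiff ℝ (⊤ : ℕ∞) (fun x : Euc d => Real.sqrt (∫ y, heatKer d ε (x - y) * f y ^ 2))
    ∧ (∫ x, ‖gradient
          (fun x : Euc d => Real.sqrt (∫ y, heatKer d ε (x - y) * f y ^ 2)) x‖ ^ 2)
        ≤ ∫ x, ‖gradient f x‖ ^ 2 := by
  have hK := heatKer_cont d ε
  have hKp := heatKer_pos' d hε
  have hKi := heatKer_integrable d hε
  have hfc := hf.continuous
  have hf'c : Continuous (fderiv ℝ f) := hf.continuous_fderiv (by simp)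
  have hf's : HasCompactSupport (fderiv ℝ f) := hsupp.fderiv (𝕜 := ℝ)
  set F : Euc d → ℝ := fun y => f y ^ 2 with hF
  have hFs : HasCompactSupport F := hsupp.comp_left (g := fun z : ℝ => z ^ 2) (by simp)
  have hFd : ContDiff ℝ (⊤ : ℕ∞) F := hf.pow 2
  set u : Euc d → ℝ := fun x => ∫ y, heatKer d ε (x - y) * f y ^ 2 with hu
  have huc : u = convolution F (heatKer d ε) (ContinuousLinearMap.mul ℝ ℝ) volume := by
    funext x
    simp [hu, convolution, hF, mul_comm]
  have cs : ∀ (x : Euc d) (φ : Euc d → ℝ), Continuous φ → HasCompactSupport φ →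
      Integrable (fun y => heatKer d ε (x - y) * φ y) := fun x φ h1 h2 =>
    Continuous.integrable_of_hasCompactSupport (by fun_prop) (h2.mul_left)
  have upos : ∀ x, 0 < u x := by
    intro x
    obtain ⟨y, hy⟩ := Function.ne_iff.mp hf0
    refine Continuous.integral_pos_of_hasCompactSupport_nonneg_nonzero (x := y) (by fun_prop) (hFs.mul_left)
      (fun y => mul_nonneg (hKp _).le (sq_nonneg _)) ?_
    have : f y ≠ 0 := hy
    exact mul_ne_zero (hKp _).ne' (pow_ne_zero 2 this)
  have usm : ContDiff ℝ (⊤ : ℕ∞) u := by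
    rw [huc]
    exact hFs.contDiff_convolution_left _ hFd hKi.locallyIntegrable
  refine ⟨fun x => Real.sqrt_pos.mpr (upos x), usm.sqrt (fun x => (upos x).ne'), ?_⟩
  simp_rw [norm_gradient_eq']
  set G : Euc d → ℝ := fun y => ‖fderiv ℝ f y‖ ^ 2 with hG
  have hGc : Continuous G := by fun_prop
  have hGs : HasCompactSupport G :=
    hf's.comp_left (g := fun z => ‖z‖ ^ 2) (by simp)
  have hGi : Integrable G := hGc.integrable_of_hasCompactSupport hGs
  set h : Euc d → ℝ := fun x => ∫ y, heatKer d ε (x - y) * G y with hh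
  have hhc : h = convolution G (heatKer d ε) (ContinuousLinearMap.mul ℝ ℝ) volume := by
    funext x
    simp [hh, convolution, mul_comm]
  have hhi : Integrable h := by
    rw [hhc]; exact hGi.integrable_convolution _ hKi
  have hhint : ∫ x, h x = ∫ x, G x := by
    rw [hhc, integral_convolution _ hGi hKi, heatKer_integral d hε]
    simp
  rw [← hhint]
  refine integral_mono_of_nonneg (Filter.Eventually.of_forall fun x => by positivity) hhi
    (Filter.Eventually.of_forall fun x => ?_)
  show ‖fderiv ℝ (fun x => √(u x)) x‖ ^ 2 ≤ h x
  have hdu : DifferentiableAt ℝ u x := usm.contDiffAt.differentiableAt (by simp)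
  rw [fderiv_sqrt hdu (upos x).ne', norm_smul, mul_pow]
  set m : ℝ := ∫ y, heatKer d ε (x - y) * (|f y| * ‖fderiv ℝ f y‖) with hm
  have hmn : 0 ≤ m := integral_nonneg fun y => mul_nonneg (hKp _).le (by positivity)
  have hnorm : ‖fderiv ℝ u x‖ ≤ 2 * m := by
    have h1 := (hFs.hasFDerivAt_convolution_left (ContinuousLinearMap.mul ℝ ℝ)
      (hFd.of_le (by simp)) hKi.locallyIntegrable x).fderiv
    rw [← huc] at h1
    rw [h1, hm, ← integral_const_mul]
    unfold convolution
    refine (norm_integral_le_integral_norm _).trans (le_of_eq (integral_congr_ae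
      (Filter.Eventually.of_forall fun y => ?_)))
    have hFy : fderiv ℝ F y = (2 * f y) • fderiv ℝ f y := by
      have := ((hf.contDiffAt (x := y)).differentiableAt (by simp)).hasFDerivAt.pow 2
      simpa using this.fderiv
    have e : (ContinuousLinearMap.mul ℝ ℝ).precompL (Euc d) (fderiv ℝ F y) (heatKer d ε (x - y))
        = heatKer d ε (x - y) • fderiv ℝ F y := by
      ext v
      simp [ContinuousLinearMap.precompL, mul_comm]
    show ‖(ContinuousLinearMap.mul ℝ ℝ).precompL (Euc d) (fderiv ℝ F y) (heatKer d ε (x - y))‖ = _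
    rw [e, hFy, norm_smul, norm_smul, Real.norm_of_nonneg (hKp _).le]
    simp only [norm_mul, Real.norm_eq_abs, abs_two]
    ring
  have hi1 := cs x F hFd.continuous hFs
  have hi2 := cs x (fun y => |f y| * ‖fderiv ℝ f y‖) (by fun_prop) (hf's.norm.mul_left)
  have hi3 := cs x G hGc hGs
  have key : ∀ s : ℝ, 0 ≤ s ^ 2 * u x - 2 * s * m + h x := by
    intro s
    have : s ^ 2 * u x - 2 * s * m + h x
        = ∫ y, heatKer d ε (x - y) * (s * |f y| - ‖fderiv ℝ f y‖) ^ 2 := by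
      simp only [hu, hm, hh]
      rw [← integral_const_mul, ← integral_const_mul,
        ← integral_sub (hi1.const_mul _) (hi2.const_mul _),
        ← integral_add (by exact (hi1.const_mul (s ^ 2)).sub (hi2.const_mul (2 * s))) hi3]
      congr 1
      funext y
      simp only [hF, hG, ← sq_abs (f y)]
      ring
    rw [this]
    exact integral_nonneg fun y => mul_nonneg (hKp _).le (sq_nonneg _)
  have k := key (m / u x)
  have hux := upos x
  have k2 : m ^ 2 / u x ≤ h x := by
    have : (m / u x) ^ 2 * u x - 2 * (m / u x) * m + h x = h x - m ^ 2 / u x := by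
      field_simp; ring
    linarith
  refine le_trans ?_ k2
  have e3 : ‖1 / (2 * √(u x))‖ ^ 2 = 1 / (4 * u x) := by
    rw [Real.norm_eq_abs, sq_abs, div_pow, mul_pow, Real.sq_sqrt hux.le]; norm_num
  rw [e3]
  calc 1 / (4 * u x) * ‖fderiv ℝ u x‖ ^ 2 ≤ 1 / (4 * u x) * (2 * m) ^ 2 := by gcongr
    _ = m ^ 2 / u x := by field_simp; ring
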